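/- There is an absolute constant C with the following property. Let Δ be a finite alphabet, let m ≥ 1, and let h : ℕ → Δ be a sequence generated by a Fibonacci-DFAO with at most m states. Then for all integers n ≥ 1 and 0 ≤ c < n, the linear subsequence i ↦ h(n·i + c) is generated by a Fibonacci-DFAO with at most C·m²·n⁴ states. -/

import Mathlib

/-- The Fibonacci (Zeckendorf) value of a binary word written msd-first:
`[x₁⋯x_ℓ] = Σ_j x_j · F_{ℓ−j+2}`. -/
def fibVal : List Bool → ℕ
  | [] => 0
  | a :: rest => (if a then Nat.fib (rest.length + 2) else 0) + fibVal rest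

/-- A binary word is a valid Fibonacci representation if it has no factor `11`. -/
def ValidFib (w : List Bool) : Prop :=
  w.Chain' (fun a b => a = false ∨ b = false)

/-- A deterministic finite automaton with output (DFAO). -/
structure DFAO (α : Type*) (σ : Type*) (Δ : Type*) where
  step : σ → α → σ
  start : σ
  out : σ → Δ

/-- The output of a DFAO on an input word. -/
def DFAO.eval {α σ Δ : Type*} (M : DFAO α σ Δ) (w : List α) : Δ :=
  M.out (w.foldl M.step M.start)

/-- `h : ℕ → Δ` is generated by a Fibonacci-DFAO with at most `m` states:
there is a DFAO with input alphabet `{0,1}` and at most `m` states whose output on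
every valid Fibonacci representation `w` (leading zeros allowed) is `h [w]`. -/
def FibGeneratedBy {Δ : Type*} (h : ℕ → Δ) (m : ℕ) : Prop :=
  ∃ (σ : Type) (_ : Fintype σ) (M : DFAO Bool σ Δ),
    Fintype.card σ ≤ m ∧ ∀ w : List Bool, ValidFib w → M.eval w = h (fibVal w)

/-- Value of `w` followed by `s` zeros. -/
def padVal (w : List Bool) (s : ℕ) : ℕ := fibVal (w ++ List.replicate s false)

/-- Last bit of a word (false when empty). -/
def lastBit (w : List Bool) : Bool := w.getLastD false

/-- Length of the interval of values having a prescribed prefix with last bit `b`. -/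
def gapLen (b : Bool) (s : ℕ) : ℕ := if b then Nat.fib (s + 1) else Nat.fib (s + 2)

/-- Greedy representation of `E` with `s` digits. -/
def greedyRep : ℕ → ℕ → List Bool
  | 0, _ => []
  | s + 1, E => if Nat.fib (s + 2) ≤ E then true :: greedyRep s (E - Nat.fib (s + 2))
      else false :: greedyRep s E

/-- The Fibonacci-like sequence with given initial values. -/
def recSeq (a b : ℕ) : ℕ → ℕ
  | 0 => a
  | 1 => b
  | s + 2 => recSeq a b (s + 1) + recSeq a b s

lemma lastBit_concat (x : List Bool) (d : Bool) : lastBit (x ++ [d]) = d := by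
  simp [lastBit]

lemma fibVal_zeros (s : ℕ) : fibVal (List.replicate s false) = 0 := by
  induction s with
  | zero => rfl
  | succ s ih => simp [List.replicate_succ, fibVal, ih]

lemma fibVal_append (x y : List Bool) :
    fibVal (x ++ y) = padVal x y.length + fibVal y := by
  induction x with
  | nil => simp [padVal, fibVal_zeros]
  | cons a x ih =>
    simp only [padVal, List.cons_append, fibVal, List.length_append, List.length_replicate] at *
    omega

lemma padVal_nil (s : ℕ) : padVal [] s = 0 := by simp [padVal, fibVal_zeros]

lemma padVal_zero (x : List Bool) : padVal x 0 = fibVal x := by simp [padVal]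

lemma padVal_rec (x : List Bool) (s : ℕ) :
    padVal x (s + 2) = padVal x (s + 1) + padVal x s := by
  induction x with
  | nil => simp [padVal_nil]
  | cons a x ih =>
    simp only [padVal, List.cons_append, fibVal, List.length_append, List.length_replicate] at *
    have : Nat.fib (x.length + (s + 2) + 2)
        = Nat.fib (x.length + s + 2) + Nat.fib (x.length + (s + 1) + 2) :=
      Nat.fib_add_two (n := x.length + s + 2)
    have h2 : x.length + s + 2 = x.length + s + 2 := rfl
    cases a
    · simp; omega
    · simp only [if_true]; omega

lemma padVal_concat (x : List Bool) (d : Bool) (s : ℕ) :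
    padVal (x ++ [d]) s = padVal x (s + 1) + if d then Nat.fib (s + 2) else 0 := by
  have h := fibVal_append x ([d] ++ List.replicate s false)
  rw [← List.append_assoc] at h
  simp only [List.length_append, List.length_replicate, List.length_singleton] at h
  rw [padVal, h, Nat.add_comm 1 s]
  simp [fibVal, fibVal_zeros]

lemma padVal_le_two (x : List Bool) (s : ℕ) : padVal x (s + 1) ≤ 2 * padVal x s := by
  induction x with
  | nil => simp [padVal_nil]
  | cons a x ih =>
    simp only [padVal, List.cons_append, fibVal, List.length_append, List.length_replicate] at *
    have h1 : Nat.fib (x.length + (s + 1) + 2)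
        = Nat.fib (x.length + s + 1) + Nat.fib (x.length + s + 2) :=
      Nat.fib_add_two (n := x.length + s + 1)
    have h2 : Nat.fib (x.length + s + 1) ≤ Nat.fib (x.length + s + 2) :=
      Nat.fib_mono (by omega)
    cases a
    · simpa using ih
    · simp only [if_true]; omega

lemma fibVal_lt (y : List Bool) : fibVal y + 2 ≤ Nat.fib (y.length + 3) := by
  induction y with
  | nil => simp [fibVal, Nat.fib]
  | cons a y ih =>
    have h1 : Nat.fib (y.length + 1 + 3) = Nat.fib (y.length + 2) + Nat.fib (y.length + 3) :=
      Nat.fib_add_two (n := y.length + 2)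
    simp only [fibVal, List.length_cons, h1]
    split_ifs <;> omega

lemma validFib_iff (x : List Bool) :
    ValidFib x ↔ x.IsChain (fun a b => a = false ∨ b = false) := Iff.rfl

lemma validFib_concat (x : List Bool) (d : Bool) :
    ValidFib (x ++ [d]) ↔ ValidFib x ∧ (lastBit x = false ∨ d = false) := by
  simp only [validFib_iff]
  unfold lastBit
  rcases List.eq_nil_or_concat x with rfl | ⟨u, e, rfl⟩
  · simp
  · simp [List.isChain_append]
    tauto

lemma validFib_prefix {x y : List Bool} (h : ValidFib (x ++ y)) : ValidFib x := by
  unfold ValidFib at *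
  exact List.IsChain.left_of_append h

lemma validFib_nil : ValidFib [] := by simp [validFib_iff]

lemma validFib_transfer (y : List Bool) : ∀ x x' : List Bool, ValidFib x' →
    lastBit x = lastBit x' → ValidFib (x ++ y) → ValidFib (x' ++ y) := by
  induction y with
  | nil => intro x x' h _ _; simpa using h
  | cons b y ih =>
    intro x x' hx' hl hv
    rw [List.append_cons] at hv ⊢
    have h1 := validFib_prefix hv
    rw [validFib_concat] at h1
    apply ih (x ++ [b]) (x' ++ [b]) _ _ hv
    · rw [validFib_concat]; exact ⟨hx', hl ▸ h1.2⟩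
    · simp [lastBit_concat]

lemma gapLen_pos (b : Bool) (s : ℕ) : 0 < gapLen b s := by
  unfold gapLen; split_ifs <;> exact Nat.fib_pos.2 (by omega)

lemma gapLen_ge (b : Bool) (s : ℕ) : Nat.fib (s + 1) ≤ gapLen b s := by
  unfold gapLen; split_ifs
  · rfl
  · exact Nat.fib_mono (by omega)

lemma gapLen_le (b : Bool) (s : ℕ) : gapLen b s ≤ Nat.fib (s + 2) := by
  unfold gapLen; split_ifs
  · exact Nat.fib_mono (by omega)
  · rfl

lemma gapLen_rec (b : Bool) (s : ℕ) :
    gapLen b (s + 2) = gapLen b (s + 1) + gapLen b s := by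
  unfold gapLen; split_ifs
  · exact (Nat.fib_add_two (n := s + 1)).trans (Nat.add_comm _ _)
  · exact (Nat.fib_add_two (n := s + 2)).trans (Nat.add_comm _ _)

lemma greedy_spec (s : ℕ) : ∀ (v : List Bool) (E : ℕ), ValidFib v → E < gapLen (lastBit v) s →
    ValidFib (v ++ greedyRep s E) ∧ fibVal (v ++ greedyRep s E) = padVal v s + E := by
  induction s with
  | zero =>
    intro v E hv hE
    have : E = 0 := by
      have := gapLen_le (lastBit v) 0
      simp at this; omega
    subst this
    simp [greedyRep, hv, padVal_zero]
  | succ s ih =>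
    intro v E hv hE
    have h3 : Nat.fib (s + 3) = Nat.fib (s + 1) + Nat.fib (s + 2) :=
      Nat.fib_add_two (n := s + 1)
    unfold greedyRep
    split_ifs with h
    · have hl : lastBit v = false := by
        by_contra hc
        rw [Bool.not_eq_false] at hc
        simp only [gapLen, hc, if_true, Nat.add_assoc, Nat.reduceAdd] at hE
        omega
      rw [List.append_cons]
      have := ih (v ++ [true]) (E - Nat.fib (s + 2))
        ((validFib_concat _ _).2 ⟨hv, Or.inl hl⟩)
        (by rw [lastBit_concat]; rw [hl] at hE; simp only [gapLen, Bool.false_eq_true, if_false, if_true, Nat.add_assoc, Nat.reduceAdd] at hE ⊢; omega)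
      refine ⟨this.1, ?_⟩
      rw [this.2, padVal_concat]; simp; omega
    · rw [List.append_cons]
      have := ih (v ++ [false]) E
        ((validFib_concat _ _).2 ⟨hv, Or.inr rfl⟩)
        (by rw [lastBit_concat]; simp [gapLen]; omega)
      refine ⟨this.1, ?_⟩
      rw [this.2, padVal_concat]; simp

lemma exists_next (v : List Bool) : ValidFib v →
    ∃ v', ValidFib v' ∧ ∀ s, padVal v' s = padVal v s + gapLen (lastBit v) s := by
  induction v using List.reverseRecOn with
  | nil =>
    intro _
    refine ⟨[true], by simp [validFib_iff], fun s => ?_⟩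
    have := padVal_concat [] true s
    simp [padVal_nil] at this ⊢
    simp [this, gapLen, lastBit]
  | append_singleton u d ih =>
    intro hv
    rw [validFib_concat] at hv
    obtain ⟨u', hu', hs⟩ := ih hv.1
    have h3 : ∀ s, Nat.fib (s + 3) = Nat.fib (s + 1) + Nat.fib (s + 2) :=
      fun s => Nat.fib_add_two (n := s + 1)
    by_cases hd : d = false ∧ lastBit u = false
    · refine ⟨u ++ [true], (validFib_concat _ _).2 ⟨hv.1, Or.inl hd.2⟩, fun s => ?_⟩
      simp [padVal_concat, lastBit_concat, hd.1, gapLen]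
    · refine ⟨u' ++ [false], (validFib_concat _ _).2 ⟨hu', Or.inr rfl⟩, fun s => ?_⟩
      have := hs (s + 1)
      have := h3 s
      cases d <;> cases hb : lastBit u <;>
        simp_all [padVal_concat, lastBit_concat, gapLen] <;> omega

lemma exists_prefix_floor (t k : ℕ) : ∃ v, ValidFib v ∧ padVal v t ≤ k ∧
    k < padVal v t + gapLen (lastBit v) t := by
  induction k with
  | zero => exact ⟨[], validFib_nil, by simp [padVal_nil], by simp [padVal_nil, gapLen_pos]⟩
  | succ k ih =>
    obtain ⟨v, hv, h1, h2⟩ := ih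
    by_cases h : k + 1 < padVal v t + gapLen (lastBit v) t
    · exact ⟨v, hv, by omega, h⟩
    · obtain ⟨v', hv', hs⟩ := exists_next v hv
      have := hs t
      have := gapLen_pos (lastBit v') t
      exact ⟨v', hv', by omega, by omega⟩

open Real in
lemma conj_bound (x : List Bool) :
    |(padVal x 1 : ℝ) - goldenRatio * padVal x 0| ≤ 1 := by
  induction x using List.reverseRecOn with
  | nil => simp [padVal_nil]
  | append_singleton u d ih =>
    have hr : (padVal u 2 : ℝ) = padVal u 1 + padVal u 0 := by
      exact_mod_cast padVal_rec u 0
    have hsq := goldenRatio_sq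
    have h1 := one_lt_goldenRatio
    have h2 := goldenRatio_lt_two
    have e : (padVal u 2 : ℝ) - goldenRatio * padVal u 1
        = (1 - goldenRatio) * (padVal u 1 - goldenRatio * padVal u 0) := by
      rw [hr]; linear_combination (-(padVal u 0 : ℝ)) * hsq
    rw [abs_le] at *
    simp only [padVal_concat]
    set p := (padVal u 1 : ℝ) - goldenRatio * padVal u 0
    cases d
    · simp only [zero_add, Nat.reduceAdd]
      simp only [Bool.false_eq_true, if_false, Nat.add_zero]
      rw [e]
      constructor <;> nlinarith
    · simp only [zero_add, Nat.reduceAdd, if_true]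
      have f3 : Nat.fib 3 = 2 := rfl
      have f2 : Nat.fib 2 = 1 := rfl
      rw [f3, f2]
      push_cast
      have : (padVal u 2 : ℝ) + 2 - goldenRatio * (padVal u 1 + 1)
        = (1 - goldenRatio) * p + (2 - goldenRatio) := by linear_combination e
      rw [this]
      constructor <;> nlinarith

lemma exists_shift (n : ℕ) (hn : 1 ≤ n) :
    ∃ t, 8 * n ≤ Nat.fib t ∧ Nat.fib (t + 2) ≤ 48 * n := by
  have hex : ∃ t, 8 * n ≤ Nat.fib t := by
    refine ⟨8 * n + 5, ?_⟩
    have := Nat.le_fib_self (n := 8 * n + 5) (by omega)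
    omega
  classical
  refine ⟨Nat.find hex, Nat.find_spec hex, ?_⟩
  obtain ⟨k, hk⟩ : ∃ k, Nat.find hex = k + 1 := by
    apply Nat.exists_eq_succ_of_ne_zero
    intro h0
    have := Nat.find_spec hex
    rw [h0] at this
    simp at this; omega
  have hlt := Nat.find_min hex (m := k) (by omega)
  rw [hk]
  rcases k with _ | k
  · have : Nat.fib (0 + 1 + 2) = 2 := rfl
    omega
  · have a1 : Nat.fib (k + 1 + 1) = Nat.fib k + Nat.fib (k + 1) := Nat.fib_add_two
    have a2 : Nat.fib (k + 1 + 2) = Nat.fib (k + 1) + Nat.fib (k + 2) := Nat.fib_add_two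
    have a3 : Nat.fib (k + 1 + 1 + 2) = Nat.fib (k + 2) + Nat.fib (k + 3) :=
      Nat.fib_add_two (n := k + 2)
    have a4 : Nat.fib k ≤ Nat.fib (k + 1) := Nat.fib_le_fib_succ
    simp only [Nat.add_assoc, Nat.reduceAdd] at *
    omega

lemma recSeq_eq (f : ℕ → ℕ) (a b : ℕ) (g : ℕ → ℕ)
    (hf : ∀ s, f (s + 2) = f (s + 1) + f s) (hg : ∀ s, g (s + 2) = g (s + 1) + g s)
    (h0 : f 0 = g 0 + a) (h1 : f 1 = g 1 + b) (s : ℕ) : f s = g s + recSeq a b s := by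
  have : f s = g s + recSeq a b s ∧ f (s + 1) = g (s + 1) + recSeq a b (s + 1) := by
    induction s with
    | zero => exact ⟨h0, h1⟩
    | succ s ih =>
      refine ⟨ih.2, ?_⟩
      have := hf s
      have := hg s
      have : recSeq a b (s + 1 + 1) = recSeq a b (s + 1) + recSeq a b s := rfl
      have := ih.1
      have := ih.2
      simp only [Nat.add_assoc, Nat.reduceAdd] at *
      omega
  exact this.1

lemma rec_upper (f g : ℕ → ℕ) (B : ℕ)
    (hf : ∀ s, f (s + 2) = f (s + 1) + f s) (hg : ∀ s, g (s + 2) = g (s + 1) + g s)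
    (h0 : f 0 ≤ g 0 + B) (h1 : f 1 ≤ g 1 + B) (s : ℕ) :
    f s ≤ g s + B * Nat.fib (s + 1) := by
  have : f s ≤ g s + B * Nat.fib (s + 1) ∧ f (s + 1) ≤ g (s + 1) + B * Nat.fib (s + 2) := by
    induction s with
    | zero => simpa using ⟨h0, h1⟩
    | succ s ih =>
      refine ⟨ih.2, ?_⟩
      have := hf s
      have := hg s
      have e : Nat.fib (s + 1 + 2) = Nat.fib (s + 1) + Nat.fib (s + 2) := Nat.fib_add_two
      rw [e, Nat.mul_add]
      have := ih.1
      have := ih.2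
      simp only [Nat.add_assoc, Nat.reduceAdd] at *
      omega
  exact this.1

/-- The arithmetic core: choice of the prefix `v`. -/
lemma exists_prefix (n t : ℕ) (hn : 1 ≤ n) (ht : 8 * n ≤ Nat.fib t)
    (ht2 : Nat.fib (t + 2) ≤ 48 * n) (x : List Bool) :
    ∃ v v' a b, ValidFib v ∧ ValidFib v' ∧
      (∀ s, padVal v' s = padVal v s + gapLen (lastBit v) s) ∧
      a < 102 * n ∧ b < 102 * n ∧
      (∀ s, n * padVal x s = padVal v (t + s) + recSeq a b s) ∧
      (∀ s, recSeq a b s ≤ gapLen (lastBit v) (t + s) + 6 * n * Nat.fib (s + 1)) := by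
  obtain ⟨v, hv, hle, hlt⟩ := exists_prefix_floor t (n * padVal x 0 - 2 * n)
  obtain ⟨v', hv', hs⟩ := exists_next v hv
  have h1 := Real.one_lt_goldenRatio
  have h2 := Real.goldenRatio_lt_two
  have cx := conj_bound x
  have cv := conj_bound (v ++ List.replicate t false)
  have cv' := conj_bound (v' ++ List.replicate t false)
  have pv : ∀ (w : List Bool) (s : ℕ), padVal (w ++ List.replicate t false) s = padVal w (t + s) := by
    intro w s
    simp only [padVal, List.append_assoc, List.replicate_append_replicate]
  rw [pv, pv, abs_le] at cv cv'
  rw [abs_le] at cx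
  simp only [Nat.add_zero] at cv cv'
  set φ := Real.goldenRatio
  have hnR : (1 : ℝ) ≤ n := by exact_mod_cast hn
  have hg := gapLen_le (lastBit v) t
  have hst := hs t
  have hst1 := hs (t + 1)
  have low0 : padVal v t ≤ n * padVal x 0 := by omega
  have low1 : padVal v (t + 1) ≤ n * padVal x 1 := by
    by_cases hc : 2 * n ≤ n * padVal x 0
    · have hR : (padVal v t : ℝ) + 2 * n ≤ n * padVal x 0 := by
        have : padVal v t + 2 * n ≤ n * padVal x 0 := by omega
        exact_mod_cast this
      have : (padVal v (t + 1) : ℝ) ≤ n * padVal x 1 := by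
        nlinarith [mul_nonneg (sub_nonneg.2 hR) (by linarith : (0:ℝ) ≤ φ),
          mul_le_mul_of_nonneg_left cx.1 (by linarith : (0:ℝ) ≤ n)]
      exact_mod_cast this
    · have : padVal v t = 0 := by omega
      have := padVal_le_two v t
      omega
  -- upper bounds
  have up0 : n * padVal x 0 < padVal v' t + 2 * n := by omega
  have up1 : n * padVal x 1 ≤ padVal v' (t + 1) + 6 * n := by
    have hR : (n : ℝ) * padVal x 0 ≤ padVal v' t + 2 * n := by exact_mod_cast up0.le
    have : (n : ℝ) * padVal x 1 ≤ padVal v' (t + 1) + 6 * n := by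
      nlinarith [mul_nonneg (sub_nonneg.2 hR) (by linarith : (0:ℝ) ≤ φ),
          mul_le_mul_of_nonneg_left cx.2 (by linarith : (0:ℝ) ≤ n)]
    exact_mod_cast this
  obtain ⟨a, ha⟩ := Nat.exists_eq_add_of_le low0
  obtain ⟨b, hb⟩ := Nat.exists_eq_add_of_le low1
  have ha' : a < 50 * n := by omega
  have hb' : b < 102 * n := by
    have hR : (a : ℝ) + 1 ≤ 50 * n := by exact_mod_cast ha'
    have haR : (n : ℝ) * padVal x 0 = padVal v t + a := by exact_mod_cast ha
    have hbR : (n : ℝ) * padVal x 1 = padVal v (t + 1) + b := by exact_mod_cast hb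
    have ha0 : (0 : ℝ) ≤ a := by positivity
    have e : (b : ℝ) = φ * a + n * (padVal x 1 - φ * padVal x 0)
        - (padVal v (t + 1) - φ * padVal v t) := by
      linear_combination (-1) * hbR + φ * haR
    have : (b : ℝ) < 102 * n := by
      nlinarith [mul_le_mul_of_nonneg_left cx.2 (by linarith : (0:ℝ) ≤ n)]
    exact_mod_cast this
  have key : ∀ s, n * padVal x s = padVal v (t + s) + recSeq a b s := by
    refine recSeq_eq (fun s => n * padVal x s) a b (fun s => padVal v (t + s)) ?_ ?_ ha hb
    · intro s; simp only [padVal_rec, Nat.mul_add]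
    · intro s; exact padVal_rec v (t + s)
  refine ⟨v, v', a, b, hv, hv', hs, by omega, hb', key, ?_⟩
  refine rec_upper (recSeq a b) (fun s => gapLen (lastBit v) (t + s)) (6 * n)
    (fun s => rfl) (fun s => gapLen_rec _ (t + s)) ?_ ?_
  · show a ≤ gapLen (lastBit v) t + 6 * n
    omega
  · show b ≤ gapLen (lastBit v) (t + 1) + 6 * n
    omega

/-- The output function on the data attached to a prefix. -/
def outFun {σ Δ : Type} (M : DFAO Bool σ Δ) (n c t a b : ℕ) (q q' : σ) (e : Bool)
    (y : List Bool) : Δ :=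
  let E := recSeq a b y.length + n * fibVal y + c
  let s := t + y.length
  if E < gapLen e s then M.out ((greedyRep s E).foldl M.step q)
  else M.out ((greedyRep s (E - gapLen e s)).foldl M.step q')

lemma outFun_spec {σ Δ : Type} (M : DFAO Bool σ Δ) (h : ℕ → Δ)
    (hM : ∀ w : List Bool, ValidFib w → M.eval w = h (fibVal w))
    (n c t : ℕ) (hn : 1 ≤ n) (hc : c < n) (ht : 8 * n ≤ Nat.fib t)
    (ht2 : Nat.fib (t + 2) ≤ 48 * n) (x : List Bool) :
    ∃ (a b : Fin (102 * n)) (q q' : σ) (e : Bool), ∀ y,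
      h (n * fibVal (x ++ y) + c) = outFun M n c t a b q q' e y := by
  obtain ⟨v, v', a, b, hv, hv', hs, ha, hb, key, hup⟩ := exists_prefix n t hn ht ht2 x
  refine ⟨⟨a, ha⟩, ⟨b, hb⟩, v.foldl M.step M.start, v'.foldl M.step M.start, lastBit v, ?_⟩
  intro y
  have hN : n * fibVal (x ++ y) + c = padVal v (t + y.length)
      + (recSeq a b y.length + n * fibVal y + c) := by
    rw [fibVal_append, Nat.mul_add, key]; ring
  unfold outFun
  simp only
  set E := recSeq a b y.length + n * fibVal y + c with hE
  rw [hN]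
  split_ifs with hlt
  · obtain ⟨g1, g2⟩ := greedy_spec (t + y.length) v E hv hlt
    rw [← g2, ← hM _ g1, DFAO.eval, List.foldl_append]
  · have hEb : E - gapLen (lastBit v) (t + y.length) < gapLen (lastBit v') (t + y.length) := by
      have b1 := hup y.length
      have b2 := fibVal_lt y
      have b3 := gapLen_ge (lastBit v') (t + y.length)
      have b4 : Nat.fib (t + y.length + 1)
          = Nat.fib t * Nat.fib y.length + Nat.fib (t + 1) * Nat.fib (y.length + 1) :=
        Nat.fib_add t y.length
      have b5 : Nat.fib t ≤ Nat.fib (t + 1) := Nat.fib_le_fib_succ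
      have b6 : Nat.fib (y.length + 2) = Nat.fib y.length + Nat.fib (y.length + 1) :=
        Nat.fib_add_two
      have b7 : Nat.fib (y.length + 3) = Nat.fib (y.length + 1) + Nat.fib (y.length + 2) :=
        Nat.fib_add_two
      have c1 : n * fibVal y + 2 * n ≤ n * Nat.fib (y.length + 3) := by nlinarith
      have c2 : 8 * n * Nat.fib (y.length + 2) ≤ Nat.fib (t + y.length + 1) := by
        rw [b4, b6, Nat.mul_add]
        gcongr
        exact ht.trans b5
      rw [b7, b6] at c1
      rw [b6] at c2
      have c3 : 0 ≤ n * Nat.fib y.length := Nat.zero_le _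
      have c4 : E < gapLen (lastBit v) (t + y.length) + Nat.fib (t + y.length + 1) := by
        nlinarith
      omega
    obtain ⟨g1, g2⟩ := greedy_spec (t + y.length) v' _ hv' hEb
    have : padVal v (t + y.length) + E = padVal v' (t + y.length)
        + (E - gapLen (lastBit v) (t + y.length)) := by
      rw [hs]; omega
    rw [this, ← g2, ← hM _ g1, DFAO.eval, List.foldl_append]

/-- Myhill-Nerode style construction. -/
lemma generated_of_data {Δ T : Type} [Fintype T] (g : ℕ → Δ) (d : List Bool → T)
    (hd : ∀ x x', ValidFib x → ValidFib x' → d x = d x' → ∀ y, ValidFib (x ++ y) →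
      ValidFib (x' ++ y) ∧ g (fibVal (x' ++ y)) = g (fibVal (x ++ y)))
    (m : ℕ) (hm : Fintype.card T ≤ m) : FibGeneratedBy g m := by
  classical
  have hrep : ∃ r : T → List Bool, ∀ x, ValidFib x → ValidFib (r (d x)) ∧ d (r (d x)) = d x := by
    refine ⟨fun τ => if H : ∃ x, ValidFib x ∧ d x = τ then H.choose else [], fun x hx => ?_⟩
    have H : ∃ x', ValidFib x' ∧ d x' = d x := ⟨x, hx, rfl⟩
    simp only [dif_pos H]
    exact H.choose_spec
  obtain ⟨r, hr⟩ := hrep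
  let M : DFAO Bool T Δ := ⟨fun τ b => d (r τ ++ [b]), d [], fun τ => g (fibVal (r τ))⟩
  have inv : ∀ w, ValidFib w → ∃ x, ValidFib x ∧ w.foldl M.step M.start = d x ∧
      ∀ y, ValidFib (w ++ y) → ValidFib (x ++ y) ∧ g (fibVal (x ++ y)) = g (fibVal (w ++ y)) := by
    intro w
    induction w using List.reverseRecOn with
    | nil => intro hw; exact ⟨[], hw, rfl, fun y hy => ⟨hy, rfl⟩⟩
    | append_singleton u b ih =>
      intro hw
      obtain ⟨x, hx, hfold, hxy⟩ := ih (validFib_prefix hw)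
      obtain ⟨hr1, hr2⟩ := hr x hx
      have step : ∀ y, ValidFib (u ++ y) → ValidFib (r (d x) ++ y) ∧
          g (fibVal (r (d x) ++ y)) = g (fibVal (u ++ y)) := by
        intro y hy
        obtain ⟨p1, p2⟩ := hxy y hy
        obtain ⟨p3, p4⟩ := hd x (r (d x)) hx hr1 hr2.symm y p1
        exact ⟨p3, p4.trans p2⟩
      refine ⟨r (d x) ++ [b], (step _ hw).1, ?_, ?_⟩
      · rw [List.foldl_append, hfold]; rfl
      · intro y hy
        rw [List.append_assoc] at hy
        rw [List.append_assoc, List.append_assoc]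
        exact step _ hy
  refine ⟨T, inferInstance, M, hm, fun w hw => ?_⟩
  obtain ⟨x, hx, hfold, hxy⟩ := inv w hw
  obtain ⟨hr1, hr2⟩ := hr x hx
  have p := hxy [] (by simpa using hw)
  have p' := hd x (r (d x)) hx hr1 hr2.symm [] (by simpa using hx)
  simp only [List.append_nil] at p p'
  rw [DFAO.eval, hfold]
  exact p'.2.trans p.2

theorem linear_subsequence_state_complexity :
    ∃ C : ℕ, ∀ (Δ : Type) (_ : Fintype Δ) (m : ℕ), 1 ≤ m →
      ∀ h : ℕ → Δ, FibGeneratedBy h m →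
        ∀ n c : ℕ, 1 ≤ n → c < n →
          FibGeneratedBy (fun i => h (n * i + c)) (C * m ^ 2 * n ^ 4) := by
  refine ⟨41616, fun Δ _ m _ h hgen n c hn hc => ?_⟩
  obtain ⟨σ, _, M, hcard, hM⟩ := hgen
  obtain ⟨t, ht, ht2⟩ := exists_shift n hn
  choose a b q q' e hspec using outFun_spec M h hM n c t hn hc ht ht2
  refine generated_of_data (T := Fin (102 * n) × Fin (102 * n) × σ × σ × Bool × Bool) _
    (fun x => (a x, b x, q x, q' x, e x, lastBit x)) ?_ _ ?_
  · intro x x' _ hx' heq y hy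
    simp only [Prod.mk.injEq] at heq
    obtain ⟨h1, h2, h3, h4, h5, h6⟩ := heq
    refine ⟨validFib_transfer y x x' hx' h6 hy, ?_⟩
    simp only [hspec, h1, h2, h3, h4, h5]
  · simp only [Fintype.card_prod, Fintype.card_fin, Fintype.card_bool]
    set k := Fintype.card σ
    calc 102 * n * (102 * n * (k * (k * (2 * 2)))) = 41616 * k ^ 2 * n ^ 2 := by ring
      _ ≤ 41616 * m ^ 2 * n ^ 4 := by
        gcongr
        norm_num
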